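/- arXiv:1811.11506 — 3 statements merged into one kernel-verified Lean document; each statement's English description precedes it below -/
import Mathlib

section
/- Let G be a group acting on a set X and let 𝐠 = (g_1, …, g_m) ∈ G^m. Define X^𝐠 := { x ∈ X : g_i • x = x for all i } and C(𝐠) := ⋂_{i=1}^m C_G(g_i) (the intersection of the centralizers of the g_i). Let C(𝐠) act on X^𝐠 × G by c • (x, k) := (c • x, k c⁻¹), and let G act on the orbit space (X^𝐠 × G)/C(𝐠) by h • [x, k] := [x, h k]. Let X_{[𝐠]} := { (x, 𝐡) ∈ X × G^m : there exists k ∈ G with 𝐡 = (k g_1 k⁻¹, …, k g_m k⁻¹) and 𝐡_i • x = x for all i }, with G acting on X_{[𝐠]} by h • (x, 𝐡) = (h • x, (h 𝐡_1 h⁻¹, …, h 𝐡_m h⁻¹)). Then the map φ : X_{[𝐠]} → (X^𝐠 × G)/C(𝐠) given by φ(x, (k g_1 k⁻¹, …, k g_m k⁻¹)) = [k⁻¹ • x, k] is well defined (independent of the choice of k) and is a G-equivariant bijection, with inverse sending [x, h] to (h • x, (h g_1 h⁻¹, …, h g_m h⁻¹)). -/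
/-- The fixed point set `X^𝐠 = {x | ∀ i, gᵢ • x = x}` of a tuple `g : Fin m → G`. -/
def fixedTuple (G X : Type*) [Group G] [MulAction G X] {m : ℕ}
    (g : Fin m → G) : Set X :=
  {x : X | ∀ i, g i • x = x}

/-- `c` lies in `C(𝐠) = ⋂ᵢ C_G(gᵢ)`, the intersection of the centralizers of the `gᵢ`. -/
def InCentTuple {G : Type*} [Group G] {m : ℕ} (g : Fin m → G) (c : G) : Prop :=
  ∀ i, c * g i = g i * c

/-- The relation on `X^𝐠 × G` whose quotient is the orbit space of the `C(𝐠)`-action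
`c • (x, k) = (c • x, k c⁻¹)`. -/
def borelRel (G X : Type*) [Group G] [MulAction G X] {m : ℕ} (g : Fin m → G) :
    (fixedTuple G X g × G) → (fixedTuple G X g × G) → Prop :=
  fun p q => ∃ c : G, InCentTuple g c ∧ (q.1 : X) = c • (p.1 : X) ∧ q.2 = p.2 * c⁻¹

/-- The orbit space `(X^𝐠 × G) / C(𝐠)`. -/
def BorelQuot (G X : Type*) [Group G] [MulAction G X] {m : ℕ} (g : Fin m → G) :=
  Quot (borelRel G X g)

/-- The `G`-action `h • [x, k] = [x, h k]` on `(X^𝐠 × G) / C(𝐠)`. -/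
def borelSMul (G X : Type*) [Group G] [MulAction G X] {m : ℕ} (g : Fin m → G)
    (h : G) : BorelQuot G X g → BorelQuot G X g :=
  Quot.lift (fun p => Quot.mk (borelRel G X g) (p.1, h * p.2)) (by
    rintro p q ⟨c, hc, h1, h2⟩
    exact Quot.sound ⟨c, hc, h1, by rw [h2, mul_assoc]⟩)

/-- The sector `X_{[𝐠]} = {(x, 𝐡) | ∃ k, 𝐡 = k 𝐠 k⁻¹ and ∀ i, 𝐡ᵢ • x = x}`. -/
def sector (G X : Type*) [Group G] [MulAction G X] {m : ℕ} (g : Fin m → G) :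
    Set (X × (Fin m → G)) :=
  {p | (∃ k : G, ∀ i, p.2 i = k * g i * k⁻¹) ∧ ∀ i, p.2 i • p.1 = p.1}

/-- The `G`-action `h • (x, 𝐡) = (h • x, h 𝐡 h⁻¹)` on the sector `X_{[𝐠]}`. -/
def sectorSMul (G X : Type*) [Group G] [MulAction G X] {m : ℕ} (g : Fin m → G)
    (h : G) (p : sector G X g) : sector G X g :=
  ⟨(h • (p : X × (Fin m → G)).1, fun i => h * (p : X × (Fin m → G)).2 i * h⁻¹), by
    obtain ⟨⟨k, hk⟩, hfix⟩ := p.2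
    refine ⟨⟨h * k, fun i => by show h * (p : X × (Fin m → G)).2 i * h⁻¹ = _; rw [hk i]; group⟩, fun i => ?_⟩
    simp only [mul_smul, inv_smul_smul]
    rw [hfix i]⟩

/-- An element `k` with `𝐡 = k 𝐠 k⁻¹` translates the point `x` of `(x, 𝐡)` into `X^𝐠`. -/
theorem inv_smul_mem_fixedTuple {G X : Type*} [Group G] [MulAction G X] {m : ℕ}
    {g : Fin m → G} (p : sector G X g) {k : G}
    (hk : ∀ i, (p : X × (Fin m → G)).2 i = k * g i * k⁻¹) :
    k⁻¹ • (p : X × (Fin m → G)).1 ∈ fixedTuple G X g := by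
  intro i
  have h := p.2.2 i
  rw [hk i, mul_smul, mul_smul] at h
  rw [eq_inv_smul_iff, h]

/-- Two elements conjugating `𝐠` to the same tuple differ by an element of `C(𝐠)`. -/
theorem inCentTuple_inv_mul {G : Type*} [Group G] {m : ℕ} {g : Fin m → G} {k l : G}
    (h : ∀ i, k * g i * k⁻¹ = l * g i * l⁻¹) : InCentTuple g (l⁻¹ * k) := by
  intro i
  calc l⁻¹ * k * g i = l⁻¹ * (k * g i * k⁻¹) * k := by group
    _ = g i * (l⁻¹ * k) := by rw [h i]; group

/-- The class `[k⁻¹ • x, k]` depends only on the point `(x, k 𝐠 k⁻¹)` of the sector. -/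
theorem borelQuot_mk_eq_of_conj_eq {G X : Type*} [Group G] [MulAction G X] {m : ℕ}
    {g : Fin m → G} (p : sector G X g) {k l : G}
    (hk : ∀ i, (p : X × (Fin m → G)).2 i = k * g i * k⁻¹)
    (hl : ∀ i, (p : X × (Fin m → G)).2 i = l * g i * l⁻¹) :
    Quot.mk (borelRel G X g) (⟨_, inv_smul_mem_fixedTuple p hk⟩, k) =
      Quot.mk (borelRel G X g) (⟨_, inv_smul_mem_fixedTuple p hl⟩, l) :=
  Quot.sound ⟨l⁻¹ * k, inCentTuple_inv_mul fun i => (hk i).symm.trans (hl i),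
    by simp [mul_smul], by simp⟩

/-- The map `(x, k) ↦ (k • x, k 𝐠 k⁻¹)` from `X^𝐠 × G` to the sector. -/
def sectorMk {G X : Type*} [Group G] [MulAction G X] {m : ℕ} (g : Fin m → G)
    (q : fixedTuple G X g × G) : sector G X g :=
  ⟨(q.2 • (q.1 : X), fun i => q.2 * g i * q.2⁻¹),
    ⟨⟨q.2, fun _ => rfl⟩, fun i => by
      simp only [mul_smul, inv_smul_smul]
      rw [q.1.2 i]⟩⟩

theorem sectorMk_eq_of_borelRel {G X : Type*} [Group G] [MulAction G X] {m : ℕ}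
    {g : Fin m → G} {p q : fixedTuple G X g × G} (h : borelRel G X g p q) :
    sectorMk g p = sectorMk g q := by
  obtain ⟨c, hc, h1, h2⟩ := h
  refine Subtype.ext (Prod.ext ?_ (funext fun i => ?_))
  · simp [sectorMk, h1, h2, mul_smul]
  · have hci : c⁻¹ * g i * c = g i := by rw [mul_assoc, ← hc i, inv_mul_cancel_left]
    calc p.2 * g i * p.2⁻¹ = p.2 * (c⁻¹ * g i * c) * p.2⁻¹ := by rw [hci]
      _ = q.2 * g i * q.2⁻¹ := by rw [h2]; group

theorem sector_equiv_borelQuot (G X : Type*) [Group G] [MulAction G X] {m : ℕ}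
    (g : Fin m → G) :
    ∃ φ : sector G X g → BorelQuot G X g,
      -- well-definedness: `φ(x, k𝐠k⁻¹) = [k⁻¹ • x, k]` for every presentation of a
      -- point of the sector
      (∀ (p : sector G X g) (k : G)
          (hk : ∀ i, (p : X × (Fin m → G)).2 i = k * g i * k⁻¹),
        φ p = Quot.mk (borelRel G X g)
          (⟨k⁻¹ • (p : X × (Fin m → G)).1, by
              intro i
              have h2 := p.2.2 i
              rw [hk i, mul_smul, mul_smul] at h2
              conv_rhs => rw [← h2]
              rw [inv_smul_smul]⟩, k)) ∧
      -- bijectivity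
      Function.Bijective φ ∧
      -- `G`-equivariance
      (∀ (h : G) (p : sector G X g),
        φ (sectorSMul G X g h p) = borelSMul G X g h (φ p)) ∧
      -- the inverse sends `[x, h]` to `(h • x, h 𝐠 h⁻¹)`
      (∀ (x : fixedTuple G X g) (h : G),
        φ ⟨(h • (x : X), fun i => h * g i * h⁻¹),
            ⟨⟨h, fun _ => rfl⟩, fun i => by
              simp only [mul_smul, inv_smul_smul]
              rw [x.2 i]⟩⟩ =
          Quot.mk (borelRel G X g) (x, h)) := by
  choose κ hκ using fun p : sector G X g => p.2.1
  let φ : sector G X g → BorelQuot G X g := fun p =>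
    Quot.mk (borelRel G X g) (⟨_, inv_smul_mem_fixedTuple p (hκ p)⟩, κ p)
  have hφ (p : sector G X g) (k : G)
      (hk : ∀ i, (p : X × (Fin m → G)).2 i = k * g i * k⁻¹) :
      φ p = Quot.mk (borelRel G X g) (⟨_, inv_smul_mem_fixedTuple p hk⟩, k) :=
    borelQuot_mk_eq_of_conj_eq p (hκ p) hk
  have hinv (q : fixedTuple G X g × G) : φ (sectorMk g q) = Quot.mk (borelRel G X g) q := by
    rw [hφ (sectorMk g q) q.2 fun _ => rfl]
    exact congrArg _ (Prod.ext (Subtype.ext (inv_smul_smul _ _)) rfl)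
  let ψ : BorelQuot G X g → sector G X g :=
    Quot.lift (sectorMk g) fun _ _ => sectorMk_eq_of_borelRel
  have hψφ : Function.LeftInverse ψ φ := fun p =>
    Subtype.ext (Prod.ext (smul_inv_smul _ _) (funext fun i => (hκ p i).symm))
  refine ⟨φ, hφ, ⟨hψφ.injective, fun y => ?_⟩, fun h p => ?_, fun x h => hinv (x, h)⟩
  · induction y using Quot.ind with
    | mk q => exact ⟨sectorMk g q, hinv q⟩
  · have hk (i) : (sectorSMul G X g h p : X × (Fin m → G)).2 i =
        h * κ p * g i * (h * κ p)⁻¹ := by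
      change h * (p : X × (Fin m → G)).2 i * h⁻¹ = _
      rw [hκ p i]
      group
    rw [hφ _ _ hk]
    refine congrArg _ (Prod.ext (Subtype.ext ?_) rfl)
    simp [sectorSMul, mul_smul]
end

section
/- Let V be a finite-dimensional complex vector space and let g_0, g_1, …, g_m be pairwise commuting linear automorphisms of V, each of finite order, satisfying g_0 ∘ g_1 ∘ ⋯ ∘ g_m = id_V. Then Σ_{i=0}^m age(g_i) − (dim_ℂ V − dim_ℂ Fix(g_0, …, g_m)) = Σ_{χ} (Σ_{i=0}^m χ(i) − 1)·dim_ℂ V_χ, where the right-hand sum runs over all functions χ : {0,…,m} → ℚ ∩ [0,1) with Σ_{i=0}^m χ(i) ≥ 2. In particular, the left-hand side is a nonnegative integer. -/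
open Complex

/-- The `w`-eigenspace of a linear automorphism `g`, i.e. the kernel of
`g - e^{2πi w}·id`, where the weight `w` is a rational number. -/
noncomputable def eigenKer {V : Type*} [AddCommGroup V] [Module ℂ V]
    (g : V ≃ₗ[ℂ] V) (w : ℚ) : Submodule ℂ V :=
  LinearMap.ker ((g : V →ₗ[ℂ] V) -
    Complex.exp (2 * Real.pi * Complex.I * (w : ℂ)) • (LinearMap.id : V →ₗ[ℂ] V))

/-- The age (degree shifting number) of a finite order automorphism `g` of order `r`:
`age g = Σ_{j=0}^{r-1} (j/r) · dim_ℂ ker(g - e^{2πij/r}·id)`. -/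
noncomputable def age {V : Type*} [AddCommGroup V] [Module ℂ V]
    (g : V ≃ₗ[ℂ] V) : ℚ :=
  ∑ j ∈ Finset.range (orderOf g),
    ((j : ℚ) / (orderOf g : ℚ)) *
      (Module.finrank ℂ (eigenKer g ((j : ℚ) / (orderOf g : ℚ))) : ℚ)

/-- The joint eigenspace `V_χ = ⋂ᵢ ker(gᵢ - e^{2πi χ(i)}·id)` of a tuple of commuting
linear automorphisms, with weight function `χ`. -/
noncomputable def jointEigenspace {V : Type*} [AddCommGroup V] [Module ℂ V]
    {m : ℕ} (g : Fin m → (V ≃ₗ[ℂ] V)) (χ : Fin m → ℚ) : Submodule ℂ V :=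
  ⨅ i, eigenKer (g i) (χ i)

/-- The common fixed subspace `Fix(g_0, …, g_m) = ⋂ᵢ ker(gᵢ - id)` of a tuple of
linear automorphisms. -/
noncomputable def fixedSpace {V : Type*} [AddCommGroup V] [Module ℂ V]
    {m : ℕ} (g : Fin m → (V ≃ₗ[ℂ] V)) : Submodule ℂ V :=
  ⨅ i, LinearMap.ker ((g i : V →ₗ[ℂ] V) - (LinearMap.id : V →ₗ[ℂ] V))

open Module

theorem Module.Basis.finrank_eq_card_filter_of_mem_iff {K V ι : Type*} [Field K] [AddCommGroup V]
    [Module K V] [Fintype ι] (b : Basis ι K V) (S : Submodule K V) (P : ι → Prop)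
    [DecidablePred P] (hS : ∀ v, v ∈ S ↔ ∀ k, b.repr v k ≠ 0 → P k) :
    finrank K S = (Finset.univ.filter P).card := by
  have hspan : S = Submodule.span K (b '' {k | P k}) := by
    ext v
    rw [hS, b.mem_span_image]
    exact ⟨fun h k hk => h k (Finsupp.mem_support_iff.1 hk),
      fun h k hk => h (Finsupp.mem_support_iff.2 hk)⟩
  have hli : LinearIndependent K fun k : {k // P k} => b k :=
    b.linearIndependent.comp _ Subtype.val_injective
  have himage : b '' {k | P k} = Set.range fun k : {k // P k} => b k := by
    ext v
    simp
  rw [hspan, himage, finrank_span_eq_card hli, Fintype.card_subtype]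

theorem Module.Basis.mem_ker_sub_smul_id_iff {K V ι : Type*} [Field K] [AddCommGroup V]
    [Module K V] (b : Basis ι K V) {T : V →ₗ[K] V} {μ : ι → K} (hT : ∀ k, T (b k) = μ k • b k)
    (c : K) (v : V) :
    v ∈ LinearMap.ker (T - c • (LinearMap.id : V →ₗ[K] V)) ↔
      ∀ k, b.repr v k ≠ 0 → μ k = c := by
  have hrepr (k : ι) : b.repr (T v) k = μ k * b.repr v k := by
    have h : b.coord k ∘ₗ T = μ k • b.coord k := by
      refine b.ext fun l => ?_
      classical
      by_cases hlk : l = k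
      · subst hlk; simp [hT]
      · simp [hT, hlk]
    simpa using LinearMap.congr_fun h v
  rw [LinearMap.mem_ker, ← b.repr.map_eq_zero_iff, Finsupp.ext_iff]
  refine forall_congr' fun k => ?_
  simp only [LinearMap.sub_apply, LinearMap.smul_apply, LinearMap.id_apply, map_sub, map_smul,
    Finsupp.sub_apply, Finsupp.smul_apply, hrepr, smul_eq_mul, Finsupp.zero_apply, ← sub_mul,
    mul_eq_zero, sub_eq_zero]
  tauto

theorem Module.End.isSemisimple_of_isOfFinOrder {V : Type*} [AddCommGroup V] [Module ℂ V]
    {T : End ℂ V} (hT : IsOfFinOrder T) : T.IsSemisimple := by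
  obtain ⟨n, hn, hTn⟩ := isOfFinOrder_iff_pow_eq_one.1 hT
  refine isSemisimple_of_squarefree_aeval_eq_zero (p := Polynomial.X ^ n - 1) ?_ ?_
  · exact (Polynomial.X_pow_sub_one_separable_iff.2 (by exact_mod_cast hn.ne')).squarefree
  · simp [hTn]

theorem Complex.exp_two_pi_mul_I_mul_ratCast_injOn {a b : ℚ} (ha : a ∈ Set.Ico (0 : ℚ) 1)
    (hb : b ∈ Set.Ico (0 : ℚ) 1)
    (h : exp (2 * Real.pi * I * (a : ℂ)) = exp (2 * Real.pi * I * (b : ℂ))) : a = b := by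
  obtain ⟨n, hn⟩ := exp_eq_exp_iff_exists_int.1 h
  have hab : (a : ℂ) = b + n := by
    refine mul_left_cancel₀ two_pi_I_ne_zero ?_
    rw [hn]; ring
  have hab' : a = b + n := by exact_mod_cast hab
  have h1 : (n : ℚ) < 1 := by linarith [ha.2, hb.1]
  have h2 : (-1 : ℚ) < n := by linarith [ha.1, hb.2]
  have h3 : n < 1 := by exact_mod_cast h1
  have h4 : -1 < n := by exact_mod_cast h2
  have : n = 0 := by omega
  simp [hab', this]

theorem Complex.exists_eq_exp_of_pow_eq_one {r : ℕ} (hr : r ≠ 0) {z : ℂ} (hz : z ^ r = 1) :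
    ∃ j < r, z = exp (2 * Real.pi * I * (((j : ℚ) / (r : ℚ) : ℚ) : ℂ)) := by
  have : NeZero r := ⟨hr⟩
  obtain ⟨j, hj, rfl⟩ := (isPrimitiveRoot_exp r hr).eq_pow_of_pow_eq_one hz
  refine ⟨j, hj, ?_⟩
  rw [← exp_nat_mul]
  congr 1
  push_cast
  ring

theorem exists_basis_iInf_eigenspace_of_commute {V κ : Type*} [AddCommGroup V] [Module ℂ V]
    [FiniteDimensional ℂ V] [Finite κ] (T : κ → End ℂ V) (hcomm : ∀ i j, Commute (T i) (T j))
    (hfin : ∀ i, IsOfFinOrder (T i)) :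
    ∃ (n : ℕ) (b : Basis (Fin n) ℂ V) (μ : Fin n → κ → ℂ), ∀ k i, T i (b k) = μ k i • b k := by
  classical
  have hmaps (i j : κ) (φ : ℂ) :
      Set.MapsTo (T i) ((T j).maxGenEigenspace φ) ((T j).maxGenEigenspace φ) :=
    End.mapsTo_maxGenEigenspace_of_comm (hcomm j i) φ
  have hint := DirectSum.isInternal_submodule_of_iSupIndep_of_iSup_eq_top
    (End.independent_iInf_maxGenEigenspace_of_forall_mapsTo T hmaps)
    (End.iSup_iInf_maxGenEigenspace_eq_top_of_forall_mapsTo T hmaps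
      fun i => End.iSup_maxGenEigenspace_eq_top (T i))
  let b := hint.collectedBasis fun _ => finBasis ℂ _
  have := FiniteDimensional.fintypeBasisIndex b
  let e := Fintype.equivFin (Σ χ : κ → ℂ,
    Fin (finrank ℂ (⨅ i, (T i).maxGenEigenspace (χ i) : Submodule ℂ V)))
  refine ⟨_, b.reindex e, fun k => (e.symm k).1, fun k i => ?_⟩
  have hmem := hint.collectedBasis_mem (fun _ => finBasis ℂ _) (e.symm k)
  have hmem_i := (Submodule.mem_iInf _).1 hmem i
  have hss := (End.isSemisimple_of_isOfFinOrder (hfin i)).isFinitelySemisimple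
  rw [hss.maxGenEigenspace_eq_eigenspace, End.mem_eigenspace_iff] at hmem_i
  rw [Basis.reindex_apply]
  exact hmem_i

/-- A simultaneous eigenbasis of commuting finite order automorphisms, with rational weights. -/
theorem exists_basis_weights {V κ : Type*} [AddCommGroup V] [Module ℂ V]
    [FiniteDimensional ℂ V] [Finite κ] (g : κ → (V ≃ₗ[ℂ] V))
    (hcomm : ∀ i j, Commute (g i) (g j)) (hfin : ∀ i, IsOfFinOrder (g i)) :
    ∃ (n : ℕ) (b : Basis (Fin n) ℂ V) (w : Fin n → κ → ℚ),
      (∀ k i, g i (b k) = exp (2 * Real.pi * I * (w k i : ℂ)) • b k) ∧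
      ∀ k i, ∃ j < orderOf (g i), w k i = (j : ℚ) / (orderOf (g i) : ℚ) := by
  let φ : (V ≃ₗ[ℂ] V) →* End ℂ V := LinearEquiv.automorphismGroup.toLinearMapMonoidHom
  obtain ⟨n, b, μ, hμ⟩ := exists_basis_iInf_eigenspace_of_commute (fun i => φ (g i))
    (fun i j => (hcomm i j).map φ) (fun i => φ.isOfFinOrder (hfin i))
  have hpow (k : Fin n) (i : κ) : μ k i ^ orderOf (g i) = 1 := by
    have h (N : ℕ) : (φ (g i) ^ N) (b k) = μ k i ^ N • b k := by
      induction N with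
      | zero => simp
      | succ N ih => rw [pow_succ', End.mul_apply, ih, map_smul, hμ, smul_smul, ← pow_succ]
    have h1 := h (orderOf (g i))
    rw [← map_pow, pow_orderOf_eq_one, map_one, End.one_apply] at h1
    refine smul_left_injective ℂ (b.ne_zero k) ?_
    simpa using h1.symm
  choose j hj hjμ using fun k i =>
    Complex.exists_eq_exp_of_pow_eq_one (hfin i).orderOf_pos.ne' (hpow k i)
  refine ⟨n, b, fun k i => (j k i : ℚ) / (orderOf (g i) : ℚ), fun k i => ?_,
    fun k i => ⟨j k i, hj k i, rfl⟩⟩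
  rw [← hjμ]
  exact hμ k i

theorem List.prod_ofFn_apply_of_forall_apply_eq_exp_smul {V : Type*} [AddCommGroup V]
    [Module ℂ V] {n : ℕ} (g : Fin n → (V ≃ₗ[ℂ] V)) (w : Fin n → ℚ) (v : V)
    (h : ∀ i, g i v = exp (2 * Real.pi * I * (w i : ℂ)) • v) :
    (List.ofFn g).prod v = exp (2 * Real.pi * I * ((∑ i, w i : ℚ) : ℂ)) • v := by
  induction n with
  | zero => simp
  | succ n ih =>
    rw [List.ofFn_succ, List.prod_cons, LinearEquiv.mul_apply,
      ih (fun i => g i.succ) (fun i => w i.succ) fun i => h i.succ, map_smul, h 0, smul_smul,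
      ← Complex.exp_add, Fin.sum_univ_succ]
    congr 2
    push_cast
    ring

theorem Complex.exists_natCast_eq_of_exp_eq_one {a : ℚ} (ha : 0 ≤ a)
    (h : exp (2 * Real.pi * I * (a : ℂ)) = 1) : ∃ N : ℕ, a = N := by
  obtain ⟨n, hn⟩ := exp_eq_one_iff.1 h
  have han : (a : ℂ) = n := by
    refine mul_left_cancel₀ two_pi_I_ne_zero ?_
    rw [hn]; ring
  have han' : a = n := by exact_mod_cast han
  lift n to ℕ using (by rw [han'] at ha; exact_mod_cast ha)
  exact ⟨n, by simpa using han'⟩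

section Weights

variable {V ι : Type*} [AddCommGroup V] [Module ℂ V]

theorem mem_eigenKer_iff_of_basis (b : Basis ι ℂ V) {g : V ≃ₗ[ℂ] V} {w : ι → ℚ}
    (hg : ∀ k, g (b k) = exp (2 * Real.pi * I * (w k : ℂ)) • b k)
    (hw : ∀ k, w k ∈ Set.Ico (0 : ℚ) 1) {c : ℚ} (hc : c ∈ Set.Ico (0 : ℚ) 1) (v : V) :
    v ∈ eigenKer g c ↔ ∀ k, b.repr v k ≠ 0 → w k = c := by
  rw [eigenKer, b.mem_ker_sub_smul_id_iff (T := (g : V →ₗ[ℂ] V)) hg]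
  refine forall₂_congr fun k _ =>
    ⟨Complex.exp_two_pi_mul_I_mul_ratCast_injOn (hw k) hc, fun h => by rw [h]⟩

theorem age_eq_sum_weights [Fintype ι] (b : Basis ι ℂ V) {g : V ≃ₗ[ℂ] V} {w : ι → ℚ}
    (hg : ∀ k, g (b k) = exp (2 * Real.pi * I * (w k : ℂ)) • b k)
    (hw : ∀ k, w k ∈ Set.Ico (0 : ℚ) 1)
    (hord : ∀ k, ∃ j < orderOf g, w k = (j : ℚ) / (orderOf g : ℚ)) :
    age g = ∑ k, w k := by
  choose j hj hjw using hord
  have hterm : ∀ l ∈ Finset.range (orderOf g),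
      ((l : ℚ) / (orderOf g : ℚ)) * (finrank ℂ (eigenKer g ((l : ℚ) / (orderOf g : ℚ))) : ℚ) =
        ∑ k with j k = l, w k := by
    intro l hl
    have hr : (0 : ℚ) < orderOf g := by
      exact_mod_cast (Nat.zero_le l).trans_lt (Finset.mem_range.1 hl)
    have hc : (l : ℚ) / (orderOf g : ℚ) ∈ Set.Ico (0 : ℚ) 1 :=
      ⟨by positivity, (div_lt_one hr).2 (by exact_mod_cast Finset.mem_range.1 hl)⟩
    have hiff (k : ι) : w k = (l : ℚ) / (orderOf g : ℚ) ↔ j k = l := by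
      rw [hjw k, div_left_inj' hr.ne', Nat.cast_inj]
    rw [b.finrank_eq_card_filter_of_mem_iff _ (fun k => j k = l) fun v => by
        simp only [mem_eigenKer_iff_of_basis b hg hw hc, hiff],
      Finset.sum_congr rfl fun k hk => (hiff k).2 (Finset.mem_filter.1 hk).2]
    simp [mul_comm]
  rw [age, Finset.sum_congr rfl hterm]
  exact Finset.sum_fiberwise_of_maps_to (fun k _ => Finset.mem_range.2 (hj k)) w

theorem finrank_jointEigenspace_eq_card [Fintype ι] (b : Basis ι ℂ V) {m : ℕ} {g : Fin m → (V ≃ₗ[ℂ] V)}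
    {w : ι → Fin m → ℚ} (hg : ∀ k i, g i (b k) = exp (2 * Real.pi * I * (w k i : ℂ)) • b k)
    (hw : ∀ k i, w k i ∈ Set.Ico (0 : ℚ) 1) {χ : Fin m → ℚ}
    (hχ : ∀ i, χ i ∈ Set.Ico (0 : ℚ) 1) :
    finrank ℂ (jointEigenspace g χ) = (Finset.univ.filter fun k => w k = χ).card := by
  refine b.finrank_eq_card_filter_of_mem_iff _ _ fun v => ?_
  simp only [jointEigenspace, Submodule.mem_iInf, funext_iff,
    fun i => mem_eigenKer_iff_of_basis b (fun k => hg k i) (fun k => hw k i) (hχ i) v]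
  exact ⟨fun h k hk i => h i k hk, fun h i k hk => h k hk i⟩

end Weights

theorem fixedSpace_eq_jointEigenspace_zero {V : Type*} [AddCommGroup V] [Module ℂ V] {m : ℕ}
    (g : Fin m → (V ≃ₗ[ℂ] V)) : fixedSpace g = jointEigenspace g 0 := by
  simp [fixedSpace, jointEigenspace, eigenKer]

theorem finsum_mem_mul_card_fiber {α ι : Type*} [Fintype ι] [DecidableEq α] (w : ι → α)
    (S : Set α) [DecidablePred (· ∈ S)] (F : α → ℚ) :
    ∑ᶠ χ ∈ S, F χ * ((Finset.univ.filter fun k => w k = χ).card : ℚ) =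
      ∑ k with w k ∈ S, F (w k) := by
  rw [Finset.sum_comp F w, finsum_mem_eq_sum_of_inter_support_eq
    (t := (Finset.univ.filter fun k => w k ∈ S).image w)]
  · refine Finset.sum_congr rfl fun χ hχ => ?_
    obtain ⟨l, hl, rfl⟩ := Finset.mem_image.1 hχ
    rw [nsmul_eq_mul, mul_comm, Finset.filter_filter]
    congr 3
    ext k
    simp only [Finset.mem_filter, Finset.mem_univ, true_and] at hl ⊢
    exact ⟨fun h => ⟨h ▸ hl, h⟩, And.right⟩
  · ext χ
    simp only [Set.mem_inter_iff, Function.mem_support, and_congr_left_iff, Finset.coe_image,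
      Set.mem_image, Finset.coe_filter, Finset.mem_univ, true_and, Set.mem_ofPred_eq]
    intro h
    obtain ⟨k, hk⟩ := Finset.card_pos.1 (Nat.pos_of_ne_zero fun h0 =>
      h (by rw [h0, Nat.cast_zero, mul_zero]))
    have hk : w k = χ := (Finset.mem_filter.1 hk).2
    exact ⟨fun hχ => ⟨k, hk ▸ hχ, hk⟩, fun ⟨l, hl, hlχ⟩ => hlχ ▸ hl⟩

theorem obstruction_dimension_formula {V : Type*} [AddCommGroup V] [Module ℂ V]
    [FiniteDimensional ℂ V] {m : ℕ} (g : Fin (m + 1) → (V ≃ₗ[ℂ] V))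
    (hcomm : ∀ i j, Commute (g i) (g j)) (hfin : ∀ i, IsOfFinOrder (g i))
    (hprod : (List.ofFn g).prod = 1) :
    ((∑ i, age (g i)) -
        ((Module.finrank ℂ V : ℚ) - (Module.finrank ℂ (fixedSpace g) : ℚ)) =
      ∑ᶠ χ ∈ {χ : Fin (m + 1) → ℚ | (∀ i, 0 ≤ χ i ∧ χ i < 1) ∧ 2 ≤ ∑ i, χ i},
        ((∑ i, χ i) - 1) * (Module.finrank ℂ (jointEigenspace g χ) : ℚ)) ∧
    (∃ n : ℕ, (∑ i, age (g i)) -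
        ((Module.finrank ℂ V : ℚ) - (Module.finrank ℂ (fixedSpace g) : ℚ)) = (n : ℚ)) := by
  classical
  obtain ⟨n, b, w, hg, hord⟩ := exists_basis_weights g hcomm hfin
  have hw (k) (i) : w k i ∈ Set.Ico (0 : ℚ) 1 := by
    obtain ⟨j, hj, hjw⟩ := hord k i
    have hr : (0 : ℚ) < orderOf (g i) := by exact_mod_cast (hfin i).orderOf_pos
    rw [hjw]
    exact ⟨by positivity, (div_lt_one hr).2 (by exact_mod_cast hj)⟩
  have hsum (k) : ∃ N : ℕ, ∑ i, w k i = N := by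
    refine Complex.exists_natCast_eq_of_exp_eq_one (Finset.sum_nonneg fun i _ => (hw k i).1) ?_
    have h := List.prod_ofFn_apply_of_forall_apply_eq_exp_smul g (w k) (b k) (hg k)
    rw [hprod, LinearEquiv.coe_one, id_eq] at h
    refine smul_left_injective ℂ (b.ne_zero k) ?_
    simpa using h.symm
  choose N hN using hsum
  have hN_zero (k) : w k = 0 ↔ N k = 0 := by
    rw [← Nat.cast_eq_zero (R := ℚ), ← hN, Finset.sum_eq_zero_iff_of_nonneg fun i _ => (hw k i).1]
    simp [funext_iff]
  have hlhs : (∑ i, age (g i)) - ((finrank ℂ V : ℚ) - (finrank ℂ (fixedSpace g) : ℚ)) =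
      ∑ k, ((N k - 1 : ℕ) : ℚ) := by
    rw [fixedSpace_eq_jointEigenspace_zero,
      finrank_jointEigenspace_eq_card b hg hw (χ := 0) (by simp), finrank_eq_card_basis b,
      Finset.sum_congr rfl fun i _ =>
        age_eq_sum_weights b (fun k => hg k i) (fun k => hw k i) fun k => hord k i,
      Finset.sum_comm, Finset.card_filter, Fintype.card, Finset.card_eq_sum_ones]
    push_cast
    rw [← Finset.sum_sub_distrib, ← Finset.sum_sub_distrib]
    refine Finset.sum_congr rfl fun k _ => ?_
    simp only [hN, hN_zero]
    rcases Nat.eq_zero_or_pos (N k) with h | h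
    · simp [h]
    · simp [h.ne', Nat.cast_pred h]
  refine ⟨?_, ∑ k, (N k - 1), by rw [hlhs]; push_cast; rfl⟩
  rw [hlhs, finsum_mem_congr rfl fun χ hχ => by
    rw [finrank_jointEigenspace_eq_card b hg hw hχ.1], finsum_mem_mul_card_fiber w _
      fun χ => (∑ i, χ i) - 1, Finset.sum_filter]
  refine Finset.sum_congr rfl fun k _ => ?_
  have hmem : w k ∈ {χ : Fin (m + 1) → ℚ | (∀ i, 0 ≤ χ i ∧ χ i < 1) ∧ 2 ≤ ∑ i, χ i} ↔
      2 ≤ N k := by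
    rw [Set.mem_ofPred_eq, hN]
    exact ⟨fun h => by exact_mod_cast h.2, fun h => ⟨hw k, by exact_mod_cast h⟩⟩
  simp only [hmem, hN]
  split_ifs with h
  · rw [Nat.cast_pred (by omega)]
  · simp [show N k - 1 = 0 by omega]
end

section
/- Let V be a finite-dimensional complex vector space and let h_1, h_2, h_3 be pairwise commuting linear automorphisms of V, each of finite order. Then Obs(h_1, h_2) + Obs(h_1 h_2, h_3) + [codim(h_1, h_2) + codim(h_1 h_2, h_3) − codim(h_1 h_2) − codim(h_1, h_2, h_3)] = Obs(h_1, h_2, h_3), as an equality of rational numbers. -/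
open Complex

/-- `codim(g_1, …, g_m) = dim_ℂ V - dim_ℂ Fix(g_1, …, g_m)`. -/
noncomputable def codim {V : Type*} [AddCommGroup V] [Module ℂ V]
    {m : ℕ} (g : Fin m → (V ≃ₗ[ℂ] V)) : ℚ :=
  (Module.finrank ℂ V : ℚ) - (Module.finrank ℂ (fixedSpace g) : ℚ)

/-- `Obs(g_1, …, g_m) = Σᵢ age(gᵢ) + age((g_1⋯g_m)⁻¹) - codim(g_1, …, g_m)`. -/
noncomputable def Obs {V : Type*} [AddCommGroup V] [Module ℂ V]
    {m : ℕ} (g : Fin m → (V ≃ₗ[ℂ] V)) : ℚ :=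
  (∑ i, age (g i)) + age ((List.ofFn g).prod)⁻¹ - codim g

section Age

variable {V : Type*} [AddCommGroup V] [Module ℂ V]

theorem mem_eigenKer {g : V ≃ₗ[ℂ] V} {w : ℚ} {x : V} :
    x ∈ eigenKer g w ↔ g x = exp (2 * Real.pi * I * (w : ℂ)) • x := by
  simp [eigenKer, sub_eq_zero]

theorem eigenKer_eq_eigenspace (g : V ≃ₗ[ℂ] V) (j r : ℕ) :
    eigenKer g ((j : ℚ) / (r : ℚ)) =
      Module.End.eigenspace (g : V →ₗ[ℂ] V) (exp (2 * Real.pi * I / r) ^ j) := by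
  ext x
  rw [mem_eigenKer, Module.End.mem_eigenspace_iff, ← exp_nat_mul]
  push_cast
  rw [show 2 * (Real.pi : ℂ) * I * (j / r) = j * (2 * Real.pi * I / r) by ring]

theorem eigenKer_add_one (g : V ≃ₗ[ℂ] V) (w : ℚ) : eigenKer g (w + 1) = eigenKer g w := by
  ext x
  rw [mem_eigenKer, mem_eigenKer]
  push_cast
  rw [mul_add, mul_one, exp_add, exp_two_pi_mul_I, mul_one]

theorem eigenKer_inv (g : V ≃ₗ[ℂ] V) (w : ℚ) : eigenKer g⁻¹ w = eigenKer g (-w) := by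
  ext x
  rw [mem_eigenKer, mem_eigenKer]
  push_cast
  rw [mul_neg, exp_neg]
  have h : exp (2 * Real.pi * I * (w : ℂ)) ≠ 0 := exp_ne_zero _
  change g.symm x = _ ↔ _
  rw [LinearEquiv.symm_apply_eq, map_smul, eq_inv_smul_iff₀ h, eq_comm]

theorem eigenKer_inv_one_sub (g : V ≃ₗ[ℂ] V) (w : ℚ) : eigenKer g⁻¹ (1 - w) = eigenKer g w := by
  rw [eigenKer_inv, ← eigenKer_add_one]
  congr 1
  ring

theorem fixedSpace_singleton (g : V ≃ₗ[ℂ] V) : fixedSpace ![g] = eigenKer g 0 := by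
  simp [fixedSpace, eigenKer]

theorem coe_pow_orderOf_eq_one (g : V ≃ₗ[ℂ] V) : (g : V →ₗ[ℂ] V) ^ orderOf g = 1 := by
  have h := congrArg (LinearEquiv.automorphismGroup.toLinearMapMonoidHom (R := ℂ) (M := V))
    (pow_orderOf_eq_one g)
  rwa [map_pow, map_one] at h

theorem isSemisimple_of_isOfFinOrder {g : V ≃ₗ[ℂ] V} (hg : IsOfFinOrder g) :
    Module.End.IsSemisimple (g : V →ₗ[ℂ] V) := by
  have hr : ((orderOf g : ℕ) : ℂ) ≠ 0 := by exact_mod_cast hg.orderOf_pos.ne'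
  refine Module.End.isSemisimple_of_squarefree_aeval_eq_zero
    (Polynomial.X_pow_sub_one_separable_iff.2 hr).squarefree ?_
  simp [coe_pow_orderOf_eq_one]

variable [FiniteDimensional ℂ V]

theorem sum_finrank_eigenKer {g : V ≃ₗ[ℂ] V} (hg : IsOfFinOrder g) :
    ∑ j ∈ Finset.range (orderOf g),
      Module.finrank ℂ (eigenKer g ((j : ℚ) / (orderOf g : ℚ))) = Module.finrank ℂ V := by
  set r := orderOf g
  have hr0 : r ≠ 0 := hg.orderOf_pos.ne'
  have : NeZero r := ⟨hr0⟩
  have hζ := isPrimitiveRoot_exp r hr0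
  rw [Finset.sum_congr rfl fun j _ ↦ by rw [eigenKer_eq_eigenspace]]
  set ζ := exp (2 * Real.pi * I / r)
  set f : Module.End ℂ V := (g : V →ₗ[ℂ] V)
  have hpow : f ^ r = 1 := coe_pow_orderOf_eq_one g
  have hind : iSupIndep fun j : Fin r ↦ f.eigenspace (ζ ^ (j : ℕ)) :=
    f.eigenspaces_iSupIndep.comp fun i j hij ↦ Fin.ext (hζ.pow_inj i.2 j.2 hij)
  have htop : ⨆ j : Fin r, f.eigenspace (ζ ^ (j : ℕ)) = ⊤ := by
    rw [eq_top_iff, ← (isSemisimple_of_isOfFinOrder hg).iSup_eigenspace_eq_top]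
    refine iSup_le fun μ ↦ ?_
    by_cases hμ : f.HasEigenvalue μ
    · obtain ⟨v, hv⟩ := hμ.exists_hasEigenvector
      have h1 : μ ^ r = 1 := by
        have h2 := hv.pow_apply r
        rw [hpow, Module.End.one_apply] at h2
        exact smul_left_injective ℂ hv.2 (by simpa using h2.symm)
      obtain ⟨i, hi, rfl⟩ := hζ.eq_pow_of_pow_eq_one h1
      exact le_iSup (fun j : Fin r ↦ f.eigenspace (ζ ^ (j : ℕ))) ⟨i, hi⟩
    · rw [Module.End.hasEigenvalue_iff, not_not] at hμ
      exact hμ ▸ bot_le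
  have hint := DirectSum.isInternal_submodule_of_iSupIndep_of_iSup_eq_top hind htop
  rw [← (LinearEquiv.ofBijective (DirectSum.coeLinearMap _) hint).finrank_eq,
    Module.finrank_directSum,
    Finset.sum_range fun j ↦ Module.finrank ℂ (f.eigenspace (ζ ^ j))]

/-- The ages of a finite order automorphism and of its inverse add up to the codimension of the
fixed subspace. -/
theorem age_add_age_inv {g : V ≃ₗ[ℂ] V} (hg : IsOfFinOrder g) :
    age g + age g⁻¹ = codim ![g] := by
  have hsum := congrArg (Nat.cast (R := ℚ)) (sum_finrank_eigenKer hg)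
  obtain ⟨n, hn⟩ := Nat.exists_eq_succ_of_ne_zero hg.orderOf_pos.ne'
  have hn0 : ((n + 1 : ℕ) : ℚ) ≠ 0 := by exact_mod_cast n.succ_ne_zero
  rw [codim, fixedSpace_singleton, age, age, orderOf_inv, ← hsum, hn, Nat.succ_eq_add_one,
    Nat.cast_sum, Finset.sum_range_succ', Finset.sum_range_succ', Finset.sum_range_succ',
    ← Finset.sum_range_reflect (fun j ↦ (((j + 1 : ℕ) : ℚ) / ((n + 1 : ℕ) : ℚ)) *
      (Module.finrank ℂ (eigenKer g⁻¹ (((j + 1 : ℕ) : ℚ) / ((n + 1 : ℕ) : ℚ))) : ℚ))]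
  simp only [Nat.cast_zero, zero_div, zero_mul, add_zero]
  rw [Nat.cast_zero, zero_div, add_sub_cancel_right, ← Finset.sum_add_distrib]
  refine Finset.sum_congr rfl fun j hj ↦ ?_
  have hj' : j < n := Finset.mem_range.1 hj
  have hw : ((n - 1 - j + 1 : ℕ) : ℚ) / ((n + 1 : ℕ) : ℚ) =
      1 - ((j + 1 : ℕ) : ℚ) / ((n + 1 : ℕ) : ℚ) := by
    rw [eq_sub_iff_add_eq, ← add_div, ← Nat.cast_add,
      show n - 1 - j + 1 + (j + 1) = n + 1 by omega, div_self hn0]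
  rw [hw, eigenKer_inv_one_sub]
  ring

end Age

theorem Obs_assoc_left {V : Type*} [AddCommGroup V] [Module ℂ V]
    [FiniteDimensional ℂ V] (h₁ h₂ h₃ : V ≃ₗ[ℂ] V)
    (hc₁₂ : Commute h₁ h₂) (hc₁₃ : Commute h₁ h₃) (hc₂₃ : Commute h₂ h₃)
    (hf₁ : IsOfFinOrder h₁) (hf₂ : IsOfFinOrder h₂) (hf₃ : IsOfFinOrder h₃) :
    Obs ![h₁, h₂] + Obs ![h₁ * h₂, h₃] +
        (codim ![h₁, h₂] + codim ![h₁ * h₂, h₃] -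
          codim ![h₁ * h₂] - codim ![h₁, h₂, h₃]) =
      Obs ![h₁, h₂, h₃] := by
  have hkey := age_add_age_inv (hc₁₂.isOfFinOrder_mul hf₁ hf₂)
  have e₂ : (List.ofFn ![h₁, h₂]).prod = h₁ * h₂ := by simp
  have e₂' : (List.ofFn ![h₁ * h₂, h₃]).prod = h₁ * h₂ * h₃ := by simp
  have e₃ : (List.ofFn ![h₁, h₂, h₃]).prod = h₁ * h₂ * h₃ := by simp [mul_assoc]
  simp only [Obs, e₂, e₂', e₃, Fin.sum_univ_two, Fin.sum_univ_three, Matrix.cons_val]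
  linarith
end
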